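/- arXiv:2604.22488 — 2 statements merged into one kernel-verified Lean document; each statement's English description precedes it below -/
import Mathlib

section
/- Let 𝓜 be a nonempty subset of 𝔖 and M ∈ 𝔏(𝓜). (i) If the closure of the sum of subspaces ∑_{A ∈ 𝓜} ker(A−M) equals 𝓗, then M is a maximal element of 𝔏(𝓜). (ii) If, additionally, 𝓜 is a finite set and the range of A−M is closed for every A ∈ 𝓜, then this condition is also necessary for M to be a maximal element of 𝔏(𝓜). -/
noncomputable section

variable {H : Type*} [NormedAddCommGroup H] [InnerProductSpace ℂ H] [CompleteSpace H]

/-- The (real) value `(Su, u)` of the quadratic form of a bounded operator `S`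
(for self-adjoint `S` the inner product `⟪Su, u⟫` is real, and equals this value). -/
def qform (S : H →L[ℂ] H) (u : H) : ℝ := (inner ℂ (S u) u : ℂ).re

/-- Löwner's partial order on bounded self-adjoint operators:
`S ≤ T` iff `(Su,u) ≤ (Tu,u)` for all `u ∈ H`. -/
def LoewnerLE (S T : H →L[ℂ] H) : Prop := ∀ u : H, qform S u ≤ qform T u

/-- The set `𝔏(𝓜)` of lower bounds of `M` within the bounded self-adjoint operators. -/
def lowerBoundsSA (M : Set (H →L[ℂ] H)) : Set (H →L[ℂ] H) :=
  {L | IsSelfAdjoint L ∧ ∀ A ∈ M, LoewnerLE L A}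

/-- `G` is the greatest element of the set `L` with respect to Löwner's order. -/
def IsGreatestSA (L : Set (H →L[ℂ] H)) (G : H →L[ℂ] H) : Prop :=
  G ∈ L ∧ ∀ X ∈ L, LoewnerLE X G

/-- `M` is a maximal element of the set `L` with respect to Löwner's order. -/
def IsMaximalSA (L : Set (H →L[ℂ] H)) (M : H →L[ℂ] H) : Prop :=
  M ∈ L ∧ ∀ X ∈ L, LoewnerLE M X → X = M

theorem qform_sub (S T : H →L[ℂ] H) (u : H) : qform (S - T) u = qform S u - qform T u := by
  simp [qform, inner_sub_left]

theorem form_cauchy (B : H →L[ℂ] H) (hB : IsSelfAdjoint B) (hp : ∀ u, 0 ≤ qform B u) (x y : H) :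
    ‖(inner ℂ (B x) y : ℂ)‖ ^ 2 ≤ qform B x * qform B y := by
  have hs : ∀ x y : H, (inner ℂ (B x) y : ℂ) = inner ℂ x (B y) := hB.isSymmetric
  let c : PreInnerProductSpace.Core ℂ H :=
    { inner := fun x y => inner ℂ (B x) y
      conj_inner_symm := fun x y => by
        rw [inner_conj_symm, hs]
      re_inner_nonneg := fun x => hp x
      add_left := fun x y z => by simp [inner_add_left]
      smul_left := fun x y r => by simp [mul_comm] }
  have h := @InnerProductSpace.Core.inner_mul_inner_self_le ℂ H _ _ _ c x y
  have h2 : ‖(inner ℂ (B y) x : ℂ)‖ = ‖(inner ℂ (B x) y : ℂ)‖ := by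
    rw [hs y x, norm_inner_symm]
  have h3 : ‖(inner ℂ (B x) y : ℂ)‖ * ‖(inner ℂ (B y) x : ℂ)‖ ≤ qform B x * qform B y := h
  rw [h2] at h3
  rw [sq]; exact h3

theorem apply_eq_zero_of_qform (B : H →L[ℂ] H) (hB : IsSelfAdjoint B) (hp : ∀ u, 0 ≤ qform B u)
    (x : H) (hx : qform B x = 0) : B x = 0 := by
  have h := form_cauchy B hB hp x (B x)
  rw [hx, zero_mul] at h
  have h1 : ‖(inner ℂ (B x) (B x) : ℂ)‖ = 0 := by
    have := norm_nonneg (inner ℂ (B x) (B x) : ℂ)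
    nlinarith
  exact inner_self_eq_zero.mp (norm_eq_zero.mp h1)

/-- Corollary 4.3: for `Mo ∈ 𝔏(M)`, (i) if the closure of `∑_{A ∈ M} ker(A - Mo)` is all of
`H`, then `Mo` is a maximal lower bound; (ii) if moreover `M` is finite and each `A - Mo`
has closed range, this condition is also necessary for maximality. -/
theorem stmt8 (M : Set (H →L[ℂ] H)) (hne : M.Nonempty)
    (hsa : ∀ A ∈ M, IsSelfAdjoint A)
    (Mo : H →L[ℂ] H) (hMo : Mo ∈ lowerBoundsSA M) :
    ((⨆ A ∈ M, LinearMap.ker ((A - Mo : H →L[ℂ] H) : H →ₗ[ℂ] H)).topologicalClosure = ⊤ →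
      IsMaximalSA (lowerBoundsSA M) Mo) ∧
    (M.Finite → (∀ A ∈ M, IsClosed ((LinearMap.range ((A - Mo : H →L[ℂ] H) : H →ₗ[ℂ] H) : Submodule ℂ H) : Set H)) →
      IsMaximalSA (lowerBoundsSA M) Mo →
      (⨆ A ∈ M, LinearMap.ker ((A - Mo : H →L[ℂ] H) : H →ₗ[ℂ] H)).topologicalClosure = ⊤) := by
  refine ⟨fun hd => ⟨hMo, fun X hX hle => ?_⟩, fun hfin hcl hmax => ?_⟩
  · have hXs : IsSelfAdjoint (X - Mo) := hX.1.sub hMo.1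
    have hXp : ∀ u, 0 ≤ qform (X - Mo) u := fun u => by
      rw [qform_sub]; exact sub_nonneg.mpr (hle u)
    have hk : (⨆ A ∈ M, LinearMap.ker ((A - Mo : H →L[ℂ] H) : H →ₗ[ℂ] H)) ≤
        LinearMap.ker ((X - Mo : H →L[ℂ] H) : H →ₗ[ℂ] H) := by
      refine iSup₂_le fun A hA u hu => ?_
      have hu' : (A - Mo) u = 0 := hu
      have h0 : qform (A - Mo) u = 0 := by simp only [qform, hu', inner_zero_left, Complex.zero_re]
      have h1 := hX.2 A hA u
      have h2 := hXp u
      rw [qform_sub] at h0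
      have h3 : qform (X - Mo) u = 0 := by
        rw [qform_sub] at h2 ⊢
        linarith
      exact apply_eq_zero_of_qform _ hXs hXp u h3
    have hc := Submodule.topologicalClosure_minimal _ hk (ContinuousLinearMap.isClosed_ker (X - Mo))
    rw [hd] at hc
    ext u
    have : (X - Mo) u = 0 := hc (Submodule.mem_top : u ∈ ⊤)
    simpa [sub_eq_zero] using this
  · rw [Submodule.topologicalClosure_eq_top_iff, Submodule.eq_bot_iff]
    intro w hw
    by_contra hw0
    have hBs : ∀ A ∈ M, IsSelfAdjoint (A - Mo) := fun A hA => (hsa A hA).sub hMo.1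
    have hBp : ∀ A ∈ M, ∀ u, 0 ≤ qform (A - Mo) u := fun A hA u => by
      rw [qform_sub]; exact sub_nonneg.mpr (hMo.2 A hA u)
    have hex : ∀ A : H →L[ℂ] H, ∃ v, A ∈ M → (A - Mo) v = w := by
      intro A
      by_cases hA : A ∈ M
      · have h1 : w ∈ (LinearMap.ker ((A - Mo : H →L[ℂ] H) : H →ₗ[ℂ] H))ᗮ :=
          Submodule.orthogonal_le (le_iSup₂_of_le A hA le_rfl) hw
        rw [ContinuousLinearMap.orthogonal_ker, (hBs A hA).adjoint_eq,
          (hcl A hA).submodule_topologicalClosure_eq] at h1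
        obtain ⟨v, hv⟩ := h1
        exact ⟨v, fun _ => hv⟩
      · exact ⟨0, fun h => absurd h hA⟩
    choose v hv using hex
    obtain ⟨K, hK⟩ := (hfin.image fun A => qform (A - Mo) (v A)).bddAbove
    have hK' : ∀ A ∈ M, qform (A - Mo) (v A) ≤ K := fun A hA => hK ⟨A, hA, rfl⟩
    have hpos : 0 < |K| + 1 := by positivity
    set e : ℝ := (|K| + 1)⁻¹ with he
    have he0 : 0 < e := inv_pos.mpr hpos
    let R : H →L[ℂ] H := InnerProductSpace.rankOne ℂ w w
    have hRs : IsSelfAdjoint R := (InnerProductSpace.isPositive_rankOne_self w).isSelfAdjoint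
    have hq : ∀ u, qform (Mo + (e : ℂ) • R) u = qform Mo u + e * ‖(inner ℂ w u : ℂ)‖ ^ 2 := by
      intro u
      have : (starRingEnd ℂ) (inner ℂ w u : ℂ) * inner ℂ w u = ((‖(inner ℂ w u : ℂ)‖ ^ 2 : ℝ) : ℂ) := by
        rw [RCLike.conj_mul]; norm_cast
      simp only [qform, R, ContinuousLinearMap.add_apply, ContinuousLinearMap.smul_apply,
        InnerProductSpace.rankOne_apply, inner_add_left, inner_smul_left, Complex.conj_ofReal,
        Complex.add_re, this]
      rw [← Complex.ofReal_mul, Complex.ofReal_re]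
    have hX : (Mo + (e : ℂ) • R) ∈ lowerBoundsSA M := by
      refine ⟨hMo.1.add (IsSelfAdjoint.smul (Complex.conj_ofReal e) hRs), fun A hA u => ?_⟩
      rw [hq]
      have h1 := form_cauchy (A - Mo) (hBs A hA) (hBp A hA) (v A) u
      rw [hv A hA] at h1
      have h2 : qform (A - Mo) (v A) * qform (A - Mo) u ≤ (|K| + 1) * qform (A - Mo) u :=
        mul_le_mul_of_nonneg_right (by linarith [hK' A hA, le_abs_self K]) (hBp A hA u)
      have h3 : e * ‖(inner ℂ w u : ℂ)‖ ^ 2 ≤ qform (A - Mo) u := by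
        rw [he, inv_mul_le_iff₀ hpos]
        exact h1.trans h2
      rw [qform_sub] at h3
      linarith
    have hXe := hmax.2 _ hX (fun u => by rw [hq]; have := sq_nonneg ‖(inner ℂ w u : ℂ)‖; nlinarith)
    have h5 := hq w
    rw [hXe] at h5
    have h6 : (inner ℂ w w : ℂ) ≠ 0 := inner_self_ne_zero.mpr hw0
    have h7 : 0 < e * ‖(inner ℂ w w : ℂ)‖ ^ 2 := by positivity
    linarith
end
end

section
/- Let 𝓜 = {A₁, …, A_n} be a finite set of pairwise commuting bounded self-adjoint operators on 𝓗. Then there exists a maximal lower bound M of 𝓜 commuting with every operator of 𝓜, and moreover, for all j, k ∈ {1,…,n}, the orthogonal complement of ker(A_j−M) ∩ ker(A_k−M) within ker(A_j−M) is orthogonal to the orthogonal complement of ker(A_j−M) ∩ ker(A_k−M) within ker(A_k−M). -/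
noncomputable section

variable {H : Type*} [NormedAddCommGroup H] [InnerProductSpace ℂ H] [CompleteSpace H]

lemma loewner_iff {H : Type*} [NormedAddCommGroup H] [InnerProductSpace ℂ H] [CompleteSpace H]
    {S T : H →L[ℂ] H} (hS : IsSelfAdjoint S) (hT : IsSelfAdjoint T) :
    LoewnerLE S T ↔ S ≤ T := by
  rw [ContinuousLinearMap.le_def, ContinuousLinearMap.isPositive_def']
  constructor
  · intro h
    refine ⟨hT.sub hS, fun u => ?_⟩
    have := h u
    simp only [qform] at this
    simp [ContinuousLinearMap.reApplyInnerSelf, inner_sub_left, this]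
  · rintro ⟨-, h⟩ u
    have := h u
    simp only [qform]
    simpa [ContinuousLinearMap.reApplyInnerSelf, inner_sub_left] using this

lemma nonneg_ker {H : Type*} [NormedAddCommGroup H] [InnerProductSpace ℂ H] [CompleteSpace H]
    {D : H →L[ℂ] H} (hD : 0 ≤ D) {z : H} (hz : qform D z ≤ 0) : D z = 0 := by
  obtain ⟨S, rfl⟩ := CStarAlgebra.nonneg_iff_eq_star_mul_self.mp hD
  have : S z = 0 := by
    simp only [qform, ContinuousLinearMap.mul_apply, ContinuousLinearMap.star_eq_adjoint,
      ContinuousLinearMap.adjoint_inner_left] at hz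
    exact re_inner_self_nonpos (𝕜 := ℂ).mp hz
  simp [this]

lemma sa_inner {H : Type*} [NormedAddCommGroup H] [InnerProductSpace ℂ H] [CompleteSpace H]
    {D : H →L[ℂ] H} (hD : IsSelfAdjoint D) (x y : H) :
    (inner ℂ (D x) y : ℂ) = inner ℂ x (D y) := by
  conv_lhs => rw [← hD.star_eq, ContinuousLinearMap.star_eq_adjoint,
    ContinuousLinearMap.adjoint_inner_left]

lemma exists_min {H : Type*} [NormedAddCommGroup H] [InnerProductSpace ℂ H] [CompleteSpace H]
    {ι : Type*} (A : ι → H →L[ℂ] H)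
    (hsa : ∀ i, IsSelfAdjoint (A i)) (hcomm : ∀ i j, Commute (A i) (A j))
    (s : Finset ι) (hs : s.Nonempty) :
    ∃ M : H →L[ℂ] H, IsSelfAdjoint M ∧ (∀ i, Commute M (A i)) ∧ (∀ i ∈ s, M ≤ A i) ∧
      ∀ x : H, (∀ i ∈ s, ∀ z : H, (A i - M) z = 0 → (inner ℂ x z : ℂ) = 0) → x = 0 := by
  induction hs using Finset.Nonempty.cons_induction with
  | singleton a =>
    refine ⟨A a, hsa a, fun i => hcomm a i, by simp, fun x hx => ?_⟩
    exact inner_self_eq_zero (𝕜 := ℂ).mp (hx a (by simp) x (by simp))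
  | cons a s h hs ih =>
    obtain ⟨M, hM, hMA, hle, hd⟩ := ih
    have hE : IsSelfAdjoint (M - A a) := hM.sub (hsa a)
    have hP0 := CFC.posPart_nonneg (M - A a)
    have hN0 := CFC.negPart_nonneg (M - A a)
    have hPN := CFC.posPart_mul_negPart (M - A a)
    have hPsub := CFC.posPart_sub_negPart (M - A a) hE
    have hc : ∀ i, Commute (M - A a) (A i) := fun i => (hMA i).sub_left (hcomm a i)
    have hcP : ∀ i, Commute ((M - A a)⁺) (A i) := fun i => (hc i).cfcₙ_real _
    have hcN : ∀ i, Commute ((M - A a)⁻) (A i) := fun i => (hc i).cfcₙ_real _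
    have hcNM : Commute ((M - A a)⁻) M :=
      Commute.cfcₙ_real ((Commute.refl M).sub_left (hMA a).symm) _
    set P := (M - A a)⁺
    set N := (M - A a)⁻
    have hPs : IsSelfAdjoint P := .of_nonneg hP0
    have hNs : IsSelfAdjoint N := .of_nonneg hN0
    have hAN : A a - (M - P) = N := by
      have : A a - (M - P) = P - (M - A a) := by abel
      rw [this, sub_eq_iff_eq_add, ← sub_eq_iff_eq_add']
      exact hPsub
    refine ⟨M - P, hM.sub hPs, fun i => (hMA i).sub_left (hcP i), ?_, ?_⟩
    · intro i hi
      rcases Finset.mem_cons.mp hi with rfl | hi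
      · rw [← sub_nonneg, hAN]; exact hN0
      · exact (sub_le_self M hP0).trans (hle i hi)
    · intro x hx
      have hNx : N x = 0 := by
        apply hd
        intro i hi z hz
        rw [sa_inner hNs]
        apply hx i (Finset.mem_cons_of_mem hi)
        have h1 : (A i - M) (N z) = 0 := by
          have : (A i - M) * N = N * (A i - M) := ((hcN i).sub_right hcNM).symm
          rw [← ContinuousLinearMap.mul_apply, this, ContinuousLinearMap.mul_apply, hz, map_zero]
        have h2 : P (N z) = 0 := by
          rw [← ContinuousLinearMap.mul_apply, hPN]; rfl
        have h3 : A i - (M - P) = (A i - M) + P := by abel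
        rw [h3, ContinuousLinearMap.add_apply, h1, h2, add_zero]
      exact inner_self_eq_zero (𝕜 := ℂ).mp (hx a (by simp) x (by rw [hAN, hNx]))

lemma proj_ker {H : Type*} [NormedAddCommGroup H] [InnerProductSpace ℂ H] [CompleteSpace H]
    {B C : H →L[ℂ] H} (hC : IsSelfAdjoint C) (hBC : Commute B C)
    {u v : H} (hu : B u = 0) (hv : C v = 0)
    (h : ∀ w, B w = 0 → C w = 0 → (inner ℂ u w : ℂ) = 0) : (inner ℂ u v : ℂ) = 0 := by
  let K : Submodule ℂ H := LinearMap.ker B.toLinearMap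
  haveI : CompleteSpace K := (ContinuousLinearMap.isClosed_ker B).completeSpace_coe
  obtain ⟨p, hp, q, hq, rfl⟩ := K.exists_add_mem_mem_orthogonal v
  have hp' : B p = 0 := hp
  have hcp : B (C p) = 0 := by
    rw [← ContinuousLinearMap.mul_apply, hBC.eq, ContinuousLinearMap.mul_apply, hp', map_zero]
  have hcp0 : C p = 0 := by
    have h1 : C p = - C q := by
      rw [map_add] at hv
      exact eq_neg_of_add_eq_zero_left hv
    have h2 : B (C (C p)) = 0 := by
      rw [← ContinuousLinearMap.mul_apply, hBC.eq, ContinuousLinearMap.mul_apply, hcp, map_zero]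
    apply inner_self_eq_zero (𝕜 := ℂ).mp
    nth_rewrite 2 [h1]
    rw [inner_neg_right, ← sa_inner hC, (Submodule.mem_orthogonal K q).mp hq _ h2, neg_zero]
  rw [inner_add_right, h p hp' hcp0, (Submodule.mem_orthogonal K q).mp hq u hu, add_zero]

/-- Theorem 6.4: for a finite set `𝓜 = {A 1, …, A n}` of pairwise commuting bounded
self-adjoint operators there is a maximal lower bound `Mo` of `𝓜` commuting with all the
`A i`; moreover for all `j, k`, the orthogonal complement of `ker(A j - Mo) ∩ ker(A k - Mo)`
within `ker(A j - Mo)` is orthogonal to the orthogonal complement of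
`ker(A j - Mo) ∩ ker(A k - Mo)` within `ker(A k - Mo)`. -/
theorem stmt17 (n : ℕ) (hn : 0 < n) (A : Fin n → H →L[ℂ] H)
    (hsa : ∀ i, IsSelfAdjoint (A i))
    (hcomm : ∀ i j, A i * A j = A j * A i) :
    ∃ Mo : H →L[ℂ] H, IsMaximalSA (lowerBoundsSA (Set.range A)) Mo ∧
      (∀ i, Mo * A i = A i * Mo) ∧
      ∀ j k : Fin n, ∀ u ∈ LinearMap.ker (A j - Mo).toLinearMap, ∀ v ∈ LinearMap.ker (A k - Mo).toLinearMap,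
        (∀ w ∈ LinearMap.ker (A j - Mo).toLinearMap ⊓ LinearMap.ker (A k - Mo).toLinearMap, (inner ℂ u w : ℂ) = 0) →
        (∀ w ∈ LinearMap.ker (A j - Mo).toLinearMap ⊓ LinearMap.ker (A k - Mo).toLinearMap, (inner ℂ v w : ℂ) = 0) →
        (inner ℂ u v : ℂ) = 0 := by
  haveI : Nonempty (Fin n) := ⟨⟨0, hn⟩⟩
  obtain ⟨M, hM, hMA, hle, hd⟩ := exists_min A hsa hcomm Finset.univ Finset.univ_nonempty
  refine ⟨M, ⟨⟨hM, ?_⟩, ?_⟩, fun i => hMA i, ?_⟩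
  · rintro _ ⟨i, rfl⟩
    exact (loewner_iff hM (hsa i)).mpr (hle i (Finset.mem_univ i))
  · rintro X ⟨hX, hXA⟩ hMX
    have hD0 : 0 ≤ X - M := sub_nonneg.mpr ((loewner_iff hM hX).mp hMX)
    rw [← sub_eq_zero]
    ext x
    apply hd
    intro i _ z hz
    rw [sa_inner (hX.sub hM)]
    have : (X - M) z = 0 := by
      apply nonneg_ker hD0
      have h1 := hXA (A i) ⟨i, rfl⟩ z
      have h2 : A i z = M z := sub_eq_zero.mp hz
      simp only [qform, h2] at h1
      simp only [qform, ContinuousLinearMap.sub_apply, inner_sub_left, Complex.sub_re]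
      linarith
    rw [this, inner_zero_right]
  · intro j k u hu v hv h _
    refine proj_ker (B := A j - M) (C := A k - M) ((hsa k).sub hM) ?_ hu hv
      fun w h1 h2 => h w ⟨h1, h2⟩
    exact ((show Commute (A j) (A k) from hcomm j k).sub_right (hMA j).symm).sub_left
      ((hMA k).sub_right (Commute.refl M))
end
end
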